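/- arXiv:2511.20829 — 3 statements merged into one kernel-verified Lean document; each statement's English description precedes it below -/
import Mathlib

section
/- For every n ≥ 1, the size of the n-th prime gap equals the number of partitions whose supernorm lies in the corresponding half-open interval: p_{n+1} − p_n = #{λ an integer partition : p_n ≤ N̂(λ) < p_{n+1}}. -/
/-- The i-th prime number, with `nthPrime 1 = 2`, `nthPrime 2 = 3`, etc. -/
noncomputable def nthPrime (i : ℕ) : ℕ := Nat.nth Nat.Prime (i - 1)

/-- The supernorm of an integer partition (a finite multiset of positive integers):
the product of the primes indexed by the parts. -/
noncomputable def supernorm (l : Multiset ℕ+) : ℕ :=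
  (l.map (fun i => nthPrime (i : ℕ))).prod

theorem prime_nthPrime (i : ℕ) : (nthPrime i).Prime :=
  Nat.prime_nth_prime _

theorem nthPrime_pnat_injective : Function.Injective fun i : ℕ+ => nthPrime (i : ℕ) := by
  intro i j h
  have hij := Nat.nth_injective Nat.infinite_setOfPred_prime h
  have hi := i.pos
  have hj := j.pos
  exact PNat.eq (by omega)

theorem exists_nthPrime_pnat_eq {p : ℕ} (hp : p.Prime) : ∃ i : ℕ+, nthPrime (i : ℕ) = p :=
  ⟨(Nat.count Nat.Prime p).succPNat, by simpa [nthPrime] using Nat.nth_count hp⟩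

theorem supernorm_eq_prod_map (l : Multiset ℕ+) :
    supernorm l = (l.map fun i : ℕ+ => nthPrime (i : ℕ)).prod := by
  simp [supernorm]

theorem supernorm_injective : Function.Injective supernorm := by
  intro l m h
  rw [supernorm_eq_prod_map, supernorm_eq_prod_map] at h
  have irreducible_of_mem (k : Multiset ℕ+) :
      ∀ p ∈ k.map (fun i : ℕ+ => nthPrime (i : ℕ)), Irreducible p := by
    intro p hp
    obtain ⟨i, -, rfl⟩ := Multiset.mem_map.1 hp
    exact prime_nthPrime i
  have hrel := UniqueFactorizationMonoid.factors_unique (irreducible_of_mem l)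
    (irreducible_of_mem m) (associated_iff_eq.2 h)
  rw [associated_eq_eq, Multiset.rel_eq] at hrel
  exact Multiset.map_injective nthPrime_pnat_injective hrel

theorem exists_supernorm_eq {k : ℕ} (hk : k ≠ 0) : ∃ l : Multiset ℕ+, supernorm l = k := by
  induction k using induction_on_primes with
  | zero => exact absurd rfl hk
  | one => exact ⟨0, rfl⟩
  | prime_mul p a hp ih =>
    obtain ⟨l, rfl⟩ := ih (right_ne_zero_of_mul hk)
    obtain ⟨i, rfl⟩ := exists_nthPrime_pnat_eq hp
    exact ⟨i ::ₘ l, by simp [supernorm_eq_prod_map]⟩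

/-- The supernorm is a bijection from partitions to positive integers, so any interval of positive
integers contains as many supernorms as it has elements. -/
theorem card_supernorm_mem_Ico {a : ℕ} (ha : a ≠ 0) (b : ℕ) :
    Nat.card {l : Multiset ℕ+ // a ≤ supernorm l ∧ supernorm l < b} = b - a := by
  have hbij : Function.Bijective
      (fun l : {l : Multiset ℕ+ // a ≤ supernorm l ∧ supernorm l < b} =>
        (⟨supernorm l, Finset.mem_Ico.2 l.2⟩ : Finset.Ico a b)) := by
    refine ⟨fun l m h => Subtype.ext (supernorm_injective (congrArg Subtype.val h)), ?_⟩
    rintro ⟨k, hk⟩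
    have hk' := Finset.mem_Ico.1 hk
    obtain ⟨l, rfl⟩ := exists_supernorm_eq (k := k) (by omega)
    exact ⟨⟨l, hk'⟩, rfl⟩
  rw [Nat.card_eq_of_bijective _ hbij, Nat.card_eq_fintype_card, Fintype.card_coe, Nat.card_Ico]

/-- For every n ≥ 1, the n-th prime gap equals the number of partitions whose
supernorm lies in the interval [pₙ, pₙ₊₁). -/
theorem prime_gap_eq_card_partitions (n : ℕ) (hn : 1 ≤ n) :
    nthPrime (n + 1) - nthPrime n =
      Nat.card {l : Multiset ℕ+ //
        nthPrime n ≤ supernorm l ∧ supernorm l < nthPrime (n + 1)} :=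
  (card_supernorm_mem_Ico (prime_nthPrime n).ne_zero _).symm
end

section
/- For every non-unitary integer partition λ (no part equal to 1), the supernorm satisfies N̂(λ) ≤ N(λ)^{log 3 / log 2}. -/
/-- The norm of an integer partition: the product of its parts. -/
def pnorm (l : Multiset ℕ+) : ℕ := (l.map (fun i => (i : ℕ))).prod

lemma cubic_gt_of_eleven_le {t : ℝ} (ht : 11 ≤ t) :
    t ^ 2 * (3 * Real.log t) + Real.log (t ^ 3 + 1) < t ^ 3 * Real.log 2 := by
  have hl2 := Real.log_two_gt_d9
  have hl2' := Real.log_two_lt_d9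
  have hlog : Real.log t ≤ t / 16 + 4 * Real.log 2 - 1 := by
    have h := Real.log_le_sub_one_of_pos (show 0 < t / 16 by positivity)
    rw [Real.log_div (by positivity) (by norm_num), show (16 : ℝ) = 2 ^ 4 by norm_num,
      Real.log_pow] at h
    norm_num at h ⊢
    linarith
  have hlog' : Real.log (t ^ 3 + 1) ≤ Real.log 2 + 3 * Real.log t := by
    have h1 : (1 : ℝ) ≤ t ^ 3 := one_le_pow₀ (by linarith)
    have h := Real.log_le_log (by positivity) (show t ^ 3 + 1 ≤ 2 * t ^ 3 by linarith)
    rw [Real.log_mul (by norm_num) (by positivity), Real.log_pow] at h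
    exact_mod_cast h
  have h1 : 3 * Real.log t ≤ 3 * t / 16 + 5.318 := by linarith
  have h2 : t ^ 2 * (3 * Real.log t) ≤ t ^ 2 * (3 * t / 16 + 5.318) := by gcongr
  have h3 : t ^ 3 * 0.6931 ≤ t ^ 3 * Real.log 2 := by gcongr; linarith
  have h4 : 11 * t ≤ t ^ 2 := by nlinarith
  have h5 : t ^ 2 * 11 ≤ t ^ 2 * t := by gcongr
  nlinarith

lemma sq_le_primeCounting_cube_of_large {p : ℕ} (hp : 1331 ≤ p) :
    p ^ 2 ≤ (Nat.primeCounting p) ^ 3 := by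
  by_contra! hlt
  have hlt' : ((Nat.primeCounting p : ℝ)) ^ 3 < (p : ℝ) ^ 2 := by exact_mod_cast hlt
  have hpR : (1331 : ℝ) ≤ p := by exact_mod_cast hp
  obtain ⟨t, ht0, htp⟩ : ∃ t : ℝ, 0 ≤ t ∧ t ^ 3 = p :=
    ⟨(p : ℝ) ^ ((3 : ℕ) : ℝ)⁻¹, by positivity,
      Real.rpow_inv_natCast_pow (by positivity) (by norm_num)⟩
  have ht : 11 ≤ t := by
    by_contra! h
    have := pow_lt_pow_left₀ h ht0 (by norm_num : 3 ≠ 0)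
    norm_num [htp] at this
    linarith
  have hn : (Nat.primeCounting p : ℝ) ≤ t ^ 2 := by
    refine le_of_lt (lt_of_pow_lt_pow_left₀ 3 (by positivity) ?_)
    calc _ < (p : ℝ) ^ 2 := hlt'
      _ = (t ^ 2) ^ 3 := by rw [← htp]; ring
  have hlogpos : 0 < Real.log p := Real.log_pos (by linarith)
  have h := Chebyshev.pi_ge p
  rw [div_le_iff₀ hlogpos] at h
  have h2 : (Nat.primeCounting p : ℝ) * Real.log p ≤ t ^ 2 * Real.log p := by gcongr
  have hlog : Real.log p = 3 * Real.log t := by rw [← htp, Real.log_pow]; norm_num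
  have h3 := cubic_gt_of_eleven_le ht
  rw [htp, ← hlog] at h3
  linarith

/-- Trial division by the primes up to `31`, valid as a primality test below `37 ^ 2`. -/
def passesTrialDivision (q : ℕ) : Bool :=
  Nat.ble 2 q && [2, 3, 5, 7, 11, 13, 17, 19, 23, 29, 31].all fun d => q % d != 0 || q == d

lemma prime_of_passesTrialDivision {q : ℕ} (hq : q < 1369) (h : passesTrialDivision q = true) :
    q.Prime := by
  simp only [passesTrialDivision, Bool.and_eq_true, Nat.ble_eq, List.all_eq_true,
    Bool.or_eq_true, bne_iff_ne, beq_iff_eq] at h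
  obtain ⟨h2, hd⟩ := h
  by_contra hnp
  have hp : q.minFac.Prime := Nat.minFac_prime (by omega)
  have hsq := Nat.minFac_sq_le_self (by omega) hnp
  have hlt : q.minFac < 37 := by nlinarith
  have hdvd : q % q.minFac = 0 := Nat.mod_eq_zero_of_dvd (Nat.minFac_dvd q)
  have hmem : q.minFac ∈ [2, 3, 5, 7, 11, 13, 17, 19, 23, 29, 31] := by
    generalize q.minFac = d at hp hlt
    interval_cases d <;> first | decide | (norm_num at hp)
  obtain h | h := hd _ hmem
  · exact h hdvd
  · exact hnp (h ▸ hp)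

lemma count_passesTrialDivision_le {a : ℕ} (ha : a < 1369) :
    Nat.count (fun q => passesTrialDivision q = true) (a + 1) ≤ Nat.primeCounting a := by
  rw [Nat.primeCounting, Nat.primeCounting', Nat.count_eq_card_filter_range,
    Nat.count_eq_card_filter_range]
  refine Finset.card_le_card fun q hq => ?_
  simp only [Finset.mem_filter, Finset.mem_range] at hq ⊢
  exact ⟨hq.1, prime_of_passesTrialDivision (by omega) hq.2⟩

lemma sq_le_primeCounting_cube_of_mem_Ico {p a b k : ℕ} (ha : a ≤ p) (hb : p < b)
    (ha' : a < 1369)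
    (hk : k ≤ Nat.count (fun q => passesTrialDivision q = true) (a + 1)) (h : b ^ 2 ≤ k ^ 3) :
    p ^ 2 ≤ (Nat.primeCounting p) ^ 3 :=
  calc p ^ 2 ≤ b ^ 2 := by gcongr
    _ ≤ k ^ 3 := h
    _ ≤ _ := by
      gcongr
      exact (hk.trans (count_passesTrialDivision_le ha')).trans (Nat.monotone_primeCounting ha)

lemma sq_le_primeCounting_cube {p : ℕ} (hp : p.Prime) (h5 : 5 ≤ p) :
    p ^ 2 ≤ (Nat.primeCounting p) ^ 3 := by
  by_cases h37 : p < 37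
  · interval_cases p <;> revert hp <;> decide +kernel
  by_cases h41 : p < 41
  · exact sq_le_primeCounting_cube_of_mem_Ico (k := 12) (not_lt.mp h37) h41
      (by norm_num) (by decide +kernel) (by norm_num)
  by_cases h46 : p < 46
  · exact sq_le_primeCounting_cube_of_mem_Ico (k := 13) (not_lt.mp h41) h46
      (by norm_num) (by decide +kernel) (by norm_num)
  by_cases h52 : p < 52
  · exact sq_le_primeCounting_cube_of_mem_Ico (k := 14) (not_lt.mp h46) h52
      (by norm_num) (by decide +kernel) (by norm_num)
  by_cases h58 : p < 58
  · exact sq_le_primeCounting_cube_of_mem_Ico (k := 15) (not_lt.mp h52) h58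
      (by norm_num) (by decide +kernel) (by norm_num)
  by_cases h64 : p < 64
  · exact sq_le_primeCounting_cube_of_mem_Ico (k := 16) (not_lt.mp h58) h64
      (by norm_num) (by decide +kernel) (by norm_num)
  by_cases h76 : p < 76
  · exact sq_le_primeCounting_cube_of_mem_Ico (k := 18) (not_lt.mp h64) h76
      (by norm_num) (by decide +kernel) (by norm_num)
  by_cases h96 : p < 96
  · exact sq_le_primeCounting_cube_of_mem_Ico (k := 21) (not_lt.mp h76) h96
      (by norm_num) (by decide +kernel) (by norm_num)
  by_cases h117 : p < 117
  · exact sq_le_primeCounting_cube_of_mem_Ico (k := 24) (not_lt.mp h96) h117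
      (by norm_num) (by decide +kernel) (by norm_num)
  by_cases h164 : p < 164
  · exact sq_le_primeCounting_cube_of_mem_Ico (k := 30) (not_lt.mp h117) h164
      (by norm_num) (by decide +kernel) (by norm_num)
  by_cases h234 : p < 234
  · exact sq_le_primeCounting_cube_of_mem_Ico (k := 38) (not_lt.mp h164) h234
      (by norm_num) (by decide +kernel) (by norm_num)
  by_cases h364 : p < 364
  · exact sq_le_primeCounting_cube_of_mem_Ico (k := 51) (not_lt.mp h234) h364
      (by norm_num) (by decide +kernel) (by norm_num)
  by_cases h610 : p < 610
  · exact sq_le_primeCounting_cube_of_mem_Ico (k := 72) (not_lt.mp h364) h610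
      (by norm_num) (by decide +kernel) (by norm_num)
  by_cases h1169 : p < 1169
  · exact sq_le_primeCounting_cube_of_mem_Ico (k := 111) (not_lt.mp h610) h1169
      (by norm_num) (by decide +kernel) (by norm_num)
  by_cases h1331 : p < 1331
  · exact sq_le_primeCounting_cube_of_mem_Ico (k := 192) (not_lt.mp h1169) h1331
      (by norm_num) (by decide +kernel) (by norm_num)
  exact sq_le_primeCounting_cube_of_large (not_lt.mp h1331)

lemma nthPrime_le_rpow {n : ℕ} (hn : 2 ≤ n) :
    (nthPrime n : ℝ) ≤ (n : ℝ) ^ (Real.log 3 / Real.log 2) := by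
  obtain ⟨m, rfl⟩ : ∃ m, n = m + 1 := ⟨n - 1, by omega⟩
  have hl2 : 0 < Real.log 2 := Real.log_pos (by norm_num)
  obtain rfl | hm : m = 1 ∨ 2 ≤ m := by omega
  · have h3 : nthPrime 2 = 3 := Nat.nth_count (p := Nat.Prime) (n := 3) Nat.prime_three
    norm_num [h3]
    rw [Real.rpow_def_of_pos (by norm_num), mul_div_cancel₀ _ hl2.ne', Real.exp_log (by norm_num)]
  · have hp : (nthPrime (m + 1)).Prime := Nat.prime_nth_prime m
    have hcount : Nat.primeCounting (nthPrime (m + 1)) = m + 1 := by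
      simp [nthPrime, Nat.primeCounting, Nat.primeCounting', Nat.count_succ, Nat.prime_nth_prime,
        Nat.count_nth_of_infinite Nat.infinite_setOfPred_prime]
    have h5 : 5 ≤ nthPrime (m + 1) := by
      have h : Nat.nth Nat.Prime 2 = 5 := Nat.nth_count (p := Nat.Prime) (n := 5) Nat.prime_five
      rw [← h]
      exact Nat.nth_monotone Nat.infinite_setOfPred_prime hm
    have hsq := sq_le_primeCounting_cube hp h5
    rw [hcount] at hsq
    have hexp : (3 / 2 : ℝ) ≤ Real.log 3 / Real.log 2 := by
      rw [le_div_iff₀ hl2]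
      have h := Real.log_le_log (by norm_num) (show (2 : ℝ) ^ 3 ≤ 3 ^ 2 by norm_num)
      rw [Real.log_pow, Real.log_pow] at h
      norm_num at h
      linarith
    calc (nthPrime (m + 1) : ℝ) ≤ ((m + 1 : ℕ) : ℝ) ^ (3 / 2 : ℝ) := by
          refine le_of_pow_le_pow_left₀ two_ne_zero (by positivity) ?_
          rw [← Real.rpow_natCast (((m + 1 : ℕ) : ℝ) ^ (3 / 2 : ℝ)), ← Real.rpow_mul (by positivity)]
          norm_num
          exact_mod_cast hsq
      _ ≤ _ := Real.rpow_le_rpow_of_exponent_le (by exact_mod_cast Nat.succ_le_succ m.zero_le) hexp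

/-- For every non-unitary partition λ, N̂(λ) ≤ N(λ)^{log 3 / log 2}. -/
theorem supernorm_le_norm_rpow (l : Multiset ℕ+) (h1 : (1 : ℕ+) ∉ l) :
    (supernorm l : ℝ) ≤ (pnorm l : ℝ) ^ (Real.log 3 / Real.log 2) := by
  induction l using Multiset.induction_on with
  | empty => simp [supernorm, pnorm]
  | cons a l ih =>
    simp only [Multiset.mem_cons, not_or] at h1
    have ha : 2 ≤ (a : ℕ) := by
      have h : (a : ℕ) ≠ 1 := fun h => h1.1 (PNat.coe_eq_one_iff.mp h).symm
      have := a.pos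
      omega
    have hs : supernorm (a ::ₘ l) = nthPrime a * supernorm l := by simp [supernorm]
    have hn : pnorm (a ::ₘ l) = a * pnorm l := by simp [pnorm]
    rw [hs, hn, Nat.cast_mul, Nat.cast_mul, Real.mul_rpow (by positivity) (by positivity)]
    exact mul_le_mul (nthPrime_le_rpow ha) (ih h1.2) (by positivity) (by positivity)
end

section
/- (Landau) The semiprime counting function satisfies π₂(x) ∼ (x / log x) · log log x as x → ∞; that is, π₂(x) · log x / (x log log x) → 1. -/
open Filter Real

/-- The number of semiprimes (positive integers with exactly two prime factors
counted with multiplicity) less than or equal to the real number x. -/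
noncomputable def semiprimeCount (x : ℝ) : ℕ :=
  {m : ℕ | 0 < m ∧ m.primeFactorsList.length = 2 ∧ (m : ℝ) ≤ x}.ncard

section FejerKernel

open MeasureTheory

/-- The Fejér kernel `(sin (x / 2) / (x / 2)) ^ 2`. -/
noncomputable def fejerKernel (x : ℝ) : ℝ := sinc (x / 2) ^ 2

lemma fejerKernel_nonneg (x : ℝ) : 0 ≤ fejerKernel x := sq_nonneg _

lemma continuous_fejerKernel : Continuous fejerKernel := by
  unfold fejerKernel
  fun_prop

lemma integrable_fejerKernel : Integrable fejerKernel := by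
  refine (integrable_inv_one_add_sq.const_mul 5).mono'
    continuous_fejerKernel.aestronglyMeasurable (ae_of_all _ fun x ↦ ?_)
  rw [norm_eq_abs, abs_of_nonneg (fejerKernel_nonneg x), ← div_eq_mul_inv,
    le_div_iff₀ (by positivity)]
  have h1 : fejerKernel x ≤ 1 := by
    unfold fejerKernel
    rw [sq_le_one_iff_abs_le_one]
    exact abs_sinc_le_one _
  have h2 : fejerKernel x * x ^ 2 ≤ 4 := by
    rcases eq_or_ne x 0 with rfl | hx
    · simp
    · rw [fejerKernel, sinc_of_ne_zero (by positivity)]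
      field_simp
      nlinarith [sin_sq_le_one (x / 2)]
  linarith

lemma integral_fejerKernel_pos : 0 < ∫ x, fejerKernel x := by
  refine integral_pos_of_integrable_nonneg_nonzero (x := 0) continuous_fejerKernel
    integrable_fejerKernel fejerKernel_nonneg ?_
  simp [fejerKernel]

lemma fejerKernel_eq_integral_cos (x : ℝ) :
    fejerKernel x = 2 * ∫ y in (0 : ℝ)..1, (1 - y) * cos (x * y) := by
  rcases eq_or_ne x 0 with rfl | hx
  · have : ∫ y in (0 : ℝ)..1, (1 - y) = 1 / 2 := by
      rw [intervalIntegral.integral_sub (by simp) (by simp)]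
      norm_num
    simp [fejerKernel, this]
  have h (y : ℝ) : HasDerivAt (fun y ↦ (1 - y) * sin (x * y) / x - cos (x * y) / x ^ 2)
      ((1 - y) * cos (x * y)) y := by
    have h0 : HasDerivAt (fun y ↦ x * y) x y := by simpa using (hasDerivAt_id y).const_mul x
    have h1 := ((((hasDerivAt_id y).const_sub 1).mul h0.sin).div_const x).sub
      (h0.cos.div_const (x ^ 2))
    refine h1.congr_deriv ?_
    simp only [id]
    field_simp
    ring
  rw [intervalIntegral.integral_eq_sub_of_hasDerivAt (fun y _ ↦ h y)
    (Continuous.intervalIntegrable (by fun_prop) _ _), fejerKernel,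
    sinc_of_ne_zero (by positivity)]
  have h2 : cos x = 1 - 2 * sin (x / 2) ^ 2 := by
    rw [← cos_sq_add_sin_sq (x / 2), show x = 2 * (x / 2) by ring, cos_two_mul']
    ring_nf
  simp [h2]
  field_simp
  ring

end FejerKernel

section LaplaceTransform

open MeasureTheory Set

variable {g : ℝ → ℝ} {B : ℝ} {G : ℂ → ℂ}

/-- The Fubini step: smoothing `g` against the Fejér kernel only sees the Laplace transform of `g`
on a bounded vertical segment. -/
lemma integral_mul_exp_mul_fejerKernel (hg : Measurable g) (hB : ∀ t > 0, |g t| ≤ B)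
    (hG : ∀ s : ℂ, 0 < s.re → G s = ∫ t in Ioi (0 : ℝ), (g t : ℂ) * Complex.exp (-s * t))
    {σ : ℝ} (hσ : 0 < σ) (l u : ℝ) :
    ∫ t in Ioi (0 : ℝ), g t * rexp (-σ * t) * fejerKernel (l * (u - t)) =
      2 * (∫ y in Ioc (0 : ℝ) 1, ((1 - y : ℝ) : ℂ) * Complex.exp (l * u * y * Complex.I) *
        G (σ + l * y * Complex.I)).re := by
  have hB0 : 0 ≤ B := (abs_nonneg _).trans (hB 1 one_pos)
  set F : ℝ → ℝ → ℂ := fun t y ↦ ((1 - y : ℝ) : ℂ) * Complex.exp (l * u * y * Complex.I) *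
    ((g t : ℂ) * Complex.exp (-(σ + l * y * Complex.I) * t)) with hF
  have hFeq (t y : ℝ) : F t y = ((g t * rexp (-σ * t) : ℝ) : ℂ) *
      (((1 - y : ℝ) : ℂ) * Complex.exp ((l * (u - t) * y : ℝ) * Complex.I)) := by
    simp only [hF]
    have : Complex.exp (l * u * y * Complex.I) * Complex.exp (-(σ + l * y * Complex.I) * t) =
        Complex.exp (-σ * t) * Complex.exp ((l * (u - t) * y : ℝ) * Complex.I) := by
      rw [← Complex.exp_add, ← Complex.exp_add]
      congr 1
      push_cast
      ring
    push_cast at this ⊢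
    linear_combination (1 - (y : ℂ)) * (g t : ℂ) * this
  have hFint : Integrable (Function.uncurry F)
      ((volume.restrict (Ioi 0)).prod (volume.restrict (Ioc 0 1))) := by
    have h1 : Integrable (fun z : ℝ × ℝ ↦ (B * rexp (-σ * z.1)) * 1)
        ((volume.restrict (Ioi 0)).prod (volume.restrict (Ioc 0 1))) :=
      Integrable.mul_prod ((integrableOn_exp_mul_Ioi (neg_neg_of_pos hσ) 0).const_mul B)
        (integrable_const 1)
    refine h1.mono' ?_ ?_
    · have : Measurable (Function.uncurry F) := by
        simp only [hF, Function.uncurry_def]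
        fun_prop
      exact this.aestronglyMeasurable
    · rw [Measure.prod_restrict]
      refine (ae_restrict_iff' (measurableSet_Ioi.prod measurableSet_Ioc)).2
        (ae_of_all _ fun z hz ↦ ?_)
      obtain ⟨hz1, hz2⟩ := hz
      simp only [Function.uncurry_def, hFeq]
      rw [norm_mul, norm_mul, Complex.norm_exp_ofReal_mul_I, Complex.norm_real, Complex.norm_real,
        mul_one, norm_mul, norm_eq_abs, norm_eq_abs, norm_eq_abs, abs_of_pos (exp_pos _),
        abs_of_nonneg (sub_nonneg.2 hz2.2)]
      gcongr
      · exact sub_nonneg.2 hz2.2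
      · exact hB _ hz1
      · linarith [hz2.1]
  have hre (t : ℝ) : g t * rexp (-σ * t) * fejerKernel (l * (u - t)) =
      2 * (∫ y in Ioc (0 : ℝ) 1, F t y).re := by
    have h2 : (∫ y in Ioc (0 : ℝ) 1, F t y).re = ∫ y in Ioc (0 : ℝ) 1, (F t y).re := by
      refine (integral_re (𝕜 := ℂ) ?_).symm
      refine Continuous.integrableOn_Ioc ?_
      simp only [hF]
      fun_prop
    rw [h2, fejerKernel_eq_integral_cos, intervalIntegral.integral_of_le zero_le_one]
    simp only [hFeq, Complex.re_ofReal_mul, Complex.exp_ofReal_mul_I_re]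
    rw [integral_const_mul]
    ring
  simp_rw [hre]
  rw [integral_const_mul]
  congr 1
  have h3 := integral_re (𝕜 := ℂ) hFint.integral_prod_left
  simp only [Function.uncurry_apply_pair, RCLike.re_to_complex] at h3
  rw [h3, integral_integral_swap hFint]
  congr 1
  refine setIntegral_congr_fun measurableSet_Ioc fun y hy ↦ ?_
  simp only [hF]
  rw [hG _ (by simpa using hσ), integral_const_mul]

/-- A Wiener–Ikehara type lemma: if the Laplace transform of a bounded function extends
continuously to the closed half-plane, its averages against the Fejér kernel tend to zero. -/
lemma tendsto_integral_mul_fejerKernel (hg : Measurable g) (hB : ∀ t > 0, |g t| ≤ B)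
    (hG : ∀ s : ℂ, 0 < s.re → G s = ∫ t in Ioi (0 : ℝ), (g t : ℂ) * Complex.exp (-s * t))
    (hGc : ContinuousOn G {s | 0 ≤ s.re}) {l : ℝ} (hl : 0 < l) :
    Tendsto (fun u ↦ ∫ t in Ioi (0 : ℝ), g t * fejerKernel (l * (u - t))) atTop (nhds 0) := by
  have hB0 : 0 ≤ B := (abs_nonneg _).trans (hB 1 one_pos)
  have hGc' : ContinuousOn (fun p : ℝ × ℝ ↦ G (p.1 + l * p.2 * Complex.I)) (Icc 0 1 ×ˢ Icc 0 1) :=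
    hGc.comp (by fun_prop) fun p hp ↦ by simpa using hp.1.1
  obtain ⟨M, hM⟩ := (isCompact_Icc.prod isCompact_Icc).exists_bound_of_continuousOn hGc'
  have key (u : ℝ) : ∫ t in Ioi (0 : ℝ), g t * fejerKernel (l * (u - t)) =
      2 * (∫ y in Ioc (0 : ℝ) 1, ((1 - y : ℝ) : ℂ) * Complex.exp (l * u * y * Complex.I) *
        G (l * y * Complex.I)).re := by
    have hmem : ∀ᶠ σ : ℝ in nhdsWithin 0 (Ioi 0), σ ∈ Ioc (0 : ℝ) 1 :=
      Ioc_mem_nhdsGT one_pos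
    have hL : Tendsto (fun σ : ℝ ↦
        ∫ t in Ioi (0 : ℝ), g t * rexp (-σ * t) * fejerKernel (l * (u - t)))
        (nhdsWithin 0 (Ioi 0)) (nhds (∫ t in Ioi (0 : ℝ), g t * fejerKernel (l * (u - t)))) := by
      refine tendsto_integral_filter_of_dominated_convergence
        (fun t ↦ B * fejerKernel (l * (u - t))) ?_ ?_ ?_ ?_
      · refine Eventually.of_forall fun σ ↦ Measurable.aestronglyMeasurable ?_
        have := continuous_fejerKernel.measurable
        fun_prop
      · filter_upwards [hmem] with σ hσ
        refine (ae_restrict_iff' measurableSet_Ioi).2 (ae_of_all _ fun t (ht : 0 < t) ↦ ?_)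
        rw [norm_mul, norm_mul, norm_eq_abs, norm_eq_abs, norm_eq_abs, abs_of_pos (exp_pos _),
          abs_of_nonneg (fejerKernel_nonneg _)]
        have h1 : rexp (-σ * t) ≤ 1 := exp_le_one_iff.2 (by nlinarith [hσ.1])
        have h2 : |g t| * rexp (-σ * t) ≤ B * 1 := by
          gcongr
          exact hB t ht
        have := fejerKernel_nonneg (l * (u - t))
        gcongr
        linarith
      · refine Integrable.integrableOn (Integrable.const_mul ?_ B)
        exact (integrable_fejerKernel.comp_mul_left' hl.ne').comp_sub_left u
      · refine ae_of_all _ fun t ↦ ?_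
        have : Tendsto (fun σ : ℝ ↦ g t * rexp (-σ * t) * fejerKernel (l * (u - t)))
            (nhds 0) (nhds (g t * rexp (-0 * t) * fejerKernel (l * (u - t)))) :=
          Continuous.tendsto (by fun_prop) 0
        simpa using this.mono_left nhdsWithin_le_nhds
    have hR : Tendsto (fun σ : ℝ ↦ ∫ y in Ioc (0 : ℝ) 1, ((1 - y : ℝ) : ℂ) *
        Complex.exp (l * u * y * Complex.I) * G (σ + l * y * Complex.I)) (nhdsWithin 0 (Ioi 0))
        (nhds (∫ y in Ioc (0 : ℝ) 1, ((1 - y : ℝ) : ℂ) * Complex.exp (l * u * y * Complex.I) *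
          G (l * y * Complex.I))) := by
      refine tendsto_integral_filter_of_dominated_convergence (fun _ ↦ M) ?_ ?_ ?_ ?_
      · filter_upwards [hmem] with σ hσ
        refine ContinuousOn.aestronglyMeasurable ?_ measurableSet_Ioc
        refine ContinuousOn.mul (by fun_prop) ?_
        exact hGc.comp (by fun_prop) fun y hy ↦ by simpa using hσ.1.le
      · filter_upwards [hmem] with σ hσ
        refine (ae_restrict_iff' measurableSet_Ioc).2 (ae_of_all _ fun y hy ↦ ?_)
        have h1 := hM (σ, y) ⟨⟨hσ.1.le, hσ.2⟩, ⟨hy.1.le, hy.2⟩⟩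
        have h2 : Complex.exp (l * u * y * Complex.I) =
          Complex.exp ((l * u * y : ℝ) * Complex.I) := by push_cast; rfl
        rw [norm_mul, norm_mul, h2, Complex.norm_exp_ofReal_mul_I, Complex.norm_real, mul_one,
          norm_eq_abs, abs_of_nonneg (by linarith [hy.2])]
        have h3 := norm_nonneg (G (σ + l * y * Complex.I))
        simp only at h1
        nlinarith [hy.1]
      · exact integrable_const M
      · refine ae_of_all _ fun y ↦ ?_
        have h1 : ContinuousWithinAt (fun σ : ℝ ↦ G (σ + l * y * Complex.I)) (Ici 0) 0 := by
          refine ContinuousOn.continuousWithinAt (s := Ici 0) ?_ (Set.mem_Ici.2 le_rfl)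
          exact hGc.comp (by fun_prop) fun y hy ↦ by simpa using hy
        have h2 : Tendsto (fun σ : ℝ ↦ G (σ + l * y * Complex.I)) (nhdsWithin 0 (Ioi 0))
            (nhds (G (l * y * Complex.I))) := by
          simpa using (h1.mono Ioi_subset_Ici_self).tendsto
        exact h2.const_mul _
    refine tendsto_nhds_unique_of_eventuallyEq hL
      ((Complex.continuous_re.tendsto _).comp hR |>.const_mul 2) ?_
    filter_upwards [self_mem_nhdsWithin] with σ hσ
    exact integral_mul_exp_mul_fejerKernel hg hB hG hσ l u
  simp_rw [key]
  set h : ℝ → ℂ := indicator (Ioc 0 1) fun y ↦ ((1 - y : ℝ) : ℂ) * G (l * y * Complex.I)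
  have hRL := Real.tendsto_integral_exp_smul_cocompact h
  have hw : Tendsto (fun u : ℝ ↦ u * (-(l / (2 * π)))) atTop (cocompact ℝ) :=
    (tendsto_id.atTop_mul_const_of_neg (neg_neg_of_pos (by positivity))).mono_right
      atBot_le_cocompact
  have h0 := ((Complex.continuous_re.tendsto _).comp (hRL.comp hw)).const_mul 2
  simp only [Complex.zero_re, mul_zero] at h0
  refine h0.congr fun u ↦ ?_
  simp only [Function.comp_apply]
  congr 2
  rw [← integral_indicator measurableSet_Ioc]
  refine integral_congr_ae (ae_of_all _ fun y ↦ ?_)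
  by_cases hy : y ∈ Ioc (0 : ℝ) 1
  · simp only [h, indicator_of_mem hy, Circle.smul_def, smul_eq_mul, fourierChar_apply]
    have : Complex.exp (↑(2 * π * -(y * (u * -(l / (2 * π))))) * Complex.I) =
        Complex.exp (l * u * y * Complex.I) := by
      congr 2
      push_cast
      field_simp
    rw [this]
    ring
  · simp [h, indicator_of_notMem hy]

end LaplaceTransform

section Tauberian

open MeasureTheory Set

variable {f k : ℝ → ℝ} {B : ℝ}

lemma tendsto_integral_Ioi_comp_sub_left (hk : Integrable k) :
    Tendsto (fun u ↦ ∫ t in Ioi (0 : ℝ), k (u - t)) atTop (nhds (∫ x, k x)) := by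
  refine ((aecover_Iio (μ := volume) tendsto_id).integral_tendsto_of_countably_generated hk).congr
    fun u ↦ ?_
  rw [← integral_indicator measurableSet_Ioi, ← integral_indicator measurableSet_Iio,
    ← integral_sub_left_eq_self _ _ u]
  congr 1 with t
  by_cases ht : 0 < t <;> simp [indicator, ht]

lemma integrableOn_mul_comp_sub_left (hf : Measurable f) (hf0 : ∀ t > 0, 0 ≤ f t)
    (hfB : ∀ t > 0, f t ≤ B) (hk : Integrable k) (w : ℝ) :
    IntegrableOn (fun t ↦ f t * k (w - t)) (Ioi 0) := by
  refine Integrable.bdd_mul (c := B) (hk.comp_sub_left w).integrableOn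
    hf.aestronglyMeasurable ?_
  refine (ae_restrict_iff' measurableSet_Ioi).2 (ae_of_all _ fun t ht ↦ ?_)
  rw [norm_eq_abs, abs_of_nonneg (hf0 t ht)]
  exact hfB t ht

lemma mul_intervalIntegral_le_integral (hf : Measurable f) (hf0 : ∀ t > 0, 0 ≤ f t)
    (hfB : ∀ t > 0, f t ≤ B) (hmono : MonotoneOn (fun t ↦ rexp t * f t) (Ioi 0))
    (hk : Integrable k) (hk0 : ∀ x, 0 ≤ k x) {d u : ℝ} (hd : 0 < d) (hu : 0 < u) :
    f u * rexp (-2 * d) * ∫ x in (-d)..d, k x ≤ ∫ t in Ioi (0 : ℝ), f t * k (u + d - t) := by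
  have hfk := integrableOn_mul_comp_sub_left hf hf0 hfB hk (u + d)
  have hsub : Ioc u (u + 2 * d) ⊆ Ioi (0 : ℝ) := fun t ht ↦ hu.trans ht.1
  calc f u * rexp (-2 * d) * ∫ x in (-d)..d, k x
      = ∫ t in Ioc u (u + 2 * d), f u * rexp (-2 * d) * k (u + d - t) := by
        rw [integral_const_mul, ← intervalIntegral.integral_of_le (by linarith),
          intervalIntegral.integral_comp_sub_left]
        congr 2 <;> ring
    _ ≤ ∫ t in Ioc u (u + 2 * d), f t * k (u + d - t) := by
        refine setIntegral_mono_on ((hk.comp_sub_left _).const_mul _).integrableOn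
          (hfk.mono_set hsub) measurableSet_Ioc fun t ht ↦ ?_
        refine mul_le_mul_of_nonneg_right ?_ (hk0 _)
        have h1 := hmono (Set.mem_Ioi.2 hu) (hsub ht) ht.1.le
        have h2 : f u * rexp (-2 * d) * rexp t ≤ f u * rexp u := by
          rw [mul_assoc, ← exp_add]
          gcongr
          · exact hf0 u hu
          · linarith [ht.2]
        simp only at h1
        refine le_of_mul_le_mul_right ?_ (exp_pos t)
        linarith
    _ ≤ _ := setIntegral_mono_set hfk
        ((ae_restrict_iff' measurableSet_Ioi).2 (ae_of_all _ fun t ht ↦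
          mul_nonneg (hf0 t ht) (hk0 _))) hsub.eventuallyLE

lemma integral_le_mul_intervalIntegral_add (hf : Measurable f) (hf0 : ∀ t > 0, 0 ≤ f t)
    (hfB : ∀ t > 0, f t ≤ B) (hmono : MonotoneOn (fun t ↦ rexp t * f t) (Ioi 0))
    (hk : Integrable k) (hk0 : ∀ x, 0 ≤ k x) {d u : ℝ} (hd : 0 < d) (hu : 2 * d < u) :
    ∫ t in Ioi (0 : ℝ), f t * k (u - d - t) ≤
      f u * rexp (2 * d) * (∫ x in (-d)..d, k x) + B * ((∫ x, k x) - ∫ x in (-d)..d, k x) := by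
  have hB : 0 ≤ B := (hf0 1 one_pos).trans (hfB 1 one_pos)
  have hfk := integrableOn_mul_comp_sub_left hf hf0 hfB hk (u - d)
  have hk' := hk.comp_sub_left (u - d)
  set s := Ioc (u - 2 * d) u
  have hsub : s ⊆ Ioi (0 : ℝ) := fun t ht ↦ by
    have := ht.1
    simp only [Set.mem_Ioi]
    linarith
  have hj : ∫ t in s, k (u - d - t) = ∫ x in (-d)..d, k x := by
    rw [← intervalIntegral.integral_of_le (by linarith), intervalIntegral.integral_comp_sub_left]
    congr 1 <;> ring
  rw [← inter_union_sdiff (Ioi (0 : ℝ)) s, inter_eq_self_of_subset_right hsub,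
    setIntegral_union disjoint_sdiff_right (measurableSet_Ioi.diff measurableSet_Ioc)
      (hfk.mono_set hsub) (hfk.mono_set sdiff_subset)]
  refine add_le_add ?_ ?_
  · rw [← hj, ← integral_const_mul]
    refine setIntegral_mono_on (hfk.mono_set hsub) (hk'.const_mul _).integrableOn
      measurableSet_Ioc fun t ht ↦ mul_le_mul_of_nonneg_right ?_ (hk0 _)
    have hu0 : 0 < u := by linarith
    have h1 := hmono (hsub ht) (Set.mem_Ioi.2 hu0) ht.2
    have h2 : f u * rexp u ≤ f u * rexp (2 * d) * rexp t := by
      rw [mul_assoc, ← exp_add]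
      gcongr
      · exact hf0 u hu0
      · linarith [ht.1]
    simp only at h1
    refine le_of_mul_le_mul_right ?_ (exp_pos t)
    linarith
  · have h3 : (∫ x, k x) - ∫ x in (-d)..d, k x = ∫ t in sᶜ, k (u - d - t) := by
      rw [setIntegral_compl measurableSet_Ioc hk', hj, integral_sub_left_eq_self]
    rw [h3, ← integral_const_mul]
    refine (setIntegral_mono_on (hfk.mono_set sdiff_subset) (hk'.const_mul B).integrableOn
      (measurableSet_Ioi.diff measurableSet_Ioc) fun t ht ↦
      mul_le_mul_of_nonneg_right (hfB t ht.1) (hk0 _)).trans ?_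
    exact setIntegral_mono_set (hk'.const_mul B).integrableOn
      (ae_of_all _ fun t ↦ mul_nonneg hB (hk0 _))
      (LE.le.eventuallyLE fun t ht ↦ ht.2)

lemma tendsto_one_of_tendsto_integral_fejerKernel (hf : Measurable f) (hf0 : ∀ t > 0, 0 ≤ f t)
    (hfB : ∀ t > 0, f t ≤ B) (hmono : MonotoneOn (fun t ↦ rexp t * f t) (Ioi 0))
    (h : ∀ l > 0, Tendsto (fun u ↦ ∫ t in Ioi (0 : ℝ), (f t - 1) * fejerKernel (l * (u - t)))
      atTop (nhds 0)) :
    Tendsto f atTop (nhds 1) := by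
  set C := ∫ x, fejerKernel x with hC
  have hC0 : 0 < C := integral_fejerKernel_pos
  set J : ℝ → ℝ := fun n ↦ ∫ x in (-n)..n, fejerKernel x with hJ
  have hJlim : Tendsto J atTop (nhds C) :=
    intervalIntegral_tendsto_integral integrable_fejerKernel tendsto_neg_atTop_atBot tendsto_id
  have hI {l : ℝ} (hl : 0 < l) : Tendsto (fun u ↦ l * ∫ t in Ioi (0 : ℝ),
      f t * fejerKernel (l * (u - t))) atTop (nhds C) := by
    have hk : Integrable (fun x ↦ fejerKernel (l * x)) :=
      integrable_fejerKernel.comp_mul_left' hl.ne'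
    have h1 := ((h l hl).add (tendsto_integral_Ioi_comp_sub_left hk)).const_mul l
    rw [Measure.integral_comp_mul_left, zero_add, smul_eq_mul, abs_of_pos (inv_pos.2 hl),
      ← mul_assoc, mul_inv_cancel₀ hl.ne', one_mul] at h1
    refine h1.congr fun u ↦ ?_
    congr 1
    have h2 := integrableOn_mul_comp_sub_left hf hf0 hfB hk u
    have h3 := (hk.comp_sub_left u).integrableOn (s := Ioi 0)
    simp only [sub_mul, one_mul]
    rw [integral_sub h2 h3]
    ring
  have hn : Tendsto (fun n : ℝ ↦ 2 * n⁻¹) atTop (nhds 0) := by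
    simpa using tendsto_inv_atTop_zero.const_mul (2 : ℝ)
  have hU : Tendsto (fun n ↦ rexp (2 * n⁻¹) * C / J n) atTop (nhds 1) := by
    have := ((continuous_exp.tendsto _).comp hn).mul_const C |>.div hJlim hC0.ne'
    simpa [Pi.div_def, div_self hC0.ne'] using this
  have hL : Tendsto (fun n ↦ rexp (-(2 * n⁻¹)) * (C - B * (C - J n)) / C) atTop (nhds 1) := by
    have := ((continuous_exp.tendsto _).comp hn.neg).mul
      (((hJlim.const_sub C).const_mul B).const_sub C) |>.div_const C
    simpa [div_self hC0.ne'] using this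
  have hscale {n : ℝ} (hn : 0 < n) : ∫ x in (-n⁻¹)..n⁻¹, fejerKernel (n ^ 2 * x) = J n / n ^ 2 := by
    rw [intervalIntegral.integral_comp_mul_left _ (by positivity), smul_eq_mul, hJ,
      inv_mul_eq_div]
    congr 2 <;> field_simp
  have hscale' {n : ℝ} (hn : 0 < n) : ∫ x, fejerKernel (n ^ 2 * x) = C / n ^ 2 := by
    rw [Measure.integral_comp_mul_left, smul_eq_mul, abs_of_pos (by positivity), inv_mul_eq_div]
  refine tendsto_order.2 ⟨fun a ha ↦ ?_, fun a ha ↦ ?_⟩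
  · obtain ⟨n, hn0, hna⟩ := ((eventually_gt_atTop (0 : ℝ)).and (hL.eventually_const_lt ha)).exists
    have hk : Integrable (fun x ↦ fejerKernel (n ^ 2 * x)) :=
      integrable_fejerKernel.comp_mul_left' (by positivity)
    have hlim := (((hI (l := n ^ 2) (by positivity)).comp
      (tendsto_atTop_add_const_right _ (-n⁻¹) tendsto_id)).sub_const (B * (C - J n))).const_mul
        (rexp (-(2 * n⁻¹))) |>.div_const C
    filter_upwards [hlim.eventually_const_lt hna, eventually_gt_atTop (2 * n⁻¹)] with u hu hu1
    have h1 := integral_le_mul_intervalIntegral_add hf hf0 hfB hmono hk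
      (fun x ↦ fejerKernel_nonneg _) (inv_pos.2 hn0) hu1
    rw [hscale hn0, hscale' hn0] at h1
    simp only [Function.comp_apply, id] at hu
    refine hu.trans_le ?_
    have hu0 : 0 < u := lt_trans (by positivity) hu1
    have hJC : J n ≤ C := by
      rw [hJ]
      simp only
      rw [intervalIntegral.integral_of_le (by linarith)]
      exact setIntegral_le_integral integrable_fejerKernel (ae_of_all _ fejerKernel_nonneg)
    rw [div_le_iff₀ hC0, exp_neg, inv_mul_le_iff₀ (exp_pos _), ← sub_eq_add_neg]
    have h2 : n ^ 2 * (∫ t in Ioi (0 : ℝ), f t * fejerKernel (n ^ 2 * (u - n⁻¹ - t))) ≤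
        f u * rexp (2 * n⁻¹) * J n + B * (C - J n) := by
      refine (mul_le_mul_of_nonneg_left h1 (by positivity)).trans_eq ?_
      field_simp
    have h3 : f u * rexp (2 * n⁻¹) * J n ≤ f u * rexp (2 * n⁻¹) * C := by
      have := hf0 u hu0
      gcongr
    linarith
  · obtain ⟨n, ⟨hn0, hJ0⟩, hna⟩ := (((eventually_gt_atTop (0 : ℝ)).and
      (hJlim.eventually_const_lt hC0)).and (hU.eventually_lt_const ha)).exists
    have hk : Integrable (fun x ↦ fejerKernel (n ^ 2 * x)) :=
      integrable_fejerKernel.comp_mul_left' (by positivity)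
    have hlim := ((hI (l := n ^ 2) (by positivity)).comp
      (tendsto_atTop_add_const_right _ n⁻¹ tendsto_id)).const_mul
        (rexp (2 * n⁻¹)) |>.div_const (J n)
    filter_upwards [hlim.eventually_lt_const hna, eventually_gt_atTop 0] with u hu hu1
    have h1 := mul_intervalIntegral_le_integral hf hf0 hfB hmono hk
      (fun x ↦ fejerKernel_nonneg _) (inv_pos.2 hn0) hu1
    rw [hscale hn0] at h1
    simp only [Function.comp_apply, id] at hu
    refine lt_of_le_of_lt ?_ hu
    rw [le_div_iff₀ hJ0, ← inv_mul_le_iff₀ (exp_pos _), ← exp_neg, ← neg_mul]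
    refine le_trans (le_of_eq ?_) (mul_le_mul_of_nonneg_left h1 (by positivity : 0 ≤ n ^ 2))
    field_simp

end Tauberian

section PrimeNumberTheorem

open MeasureTheory Set Chebyshev ArithmeticFunction

lemma LSeries_vonMangoldt_eq_mul_integral_psi {s : ℂ} (hs : 0 < s.re) :
    LSeries (fun n ↦ (Λ n : ℂ)) (s + 1) =
      (s + 1) * ∫ t in Ioi (0 : ℝ),
        ((psi (rexp t) * rexp (-t) : ℝ) : ℂ) * Complex.exp (-s * t) := by
  rw [LSeries_eq_mul_integral_of_nonneg (fun n ↦ Λ n) zero_le_one (by simpa using hs) ?_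
    fun n ↦ vonMangoldt_nonneg]
  · congr 1
    have h1 : Set.image rexp (Ioi 0) = Ioi 1 := by
      ext x
      refine ⟨?_, fun (hx : 1 < x) ↦ ⟨Real.log x, log_pos hx, exp_log (by linarith)⟩⟩
      rintro ⟨t, ht, rfl⟩
      exact one_lt_exp_iff.2 ht
    rw [← h1, integral_image_eq_integral_abs_deriv_smul measurableSet_Ioi
      (fun x _ ↦ (Real.hasDerivAt_exp x).hasDerivWithinAt) exp_injective.injOn]
    refine setIntegral_congr_fun measurableSet_Ioi fun t _ ↦ ?_
    have h2 : ∑ k ∈ Finset.Icc 1 ⌊rexp t⌋₊, (Λ k : ℂ) = psi (rexp t) := by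
      rw [psi]
      push_cast
      rfl
    simp only [h2, abs_exp, Complex.real_smul]
    rw [Complex.cpow_def_of_ne_zero (by exact_mod_cast (exp_pos t).ne'),
      ← Complex.ofReal_log (exp_pos t).le, log_exp]
    push_cast
    rw [mul_left_comm, mul_assoc, ← Complex.exp_add, ← Complex.exp_add]
    congr 2
    ring
  · refine Asymptotics.IsBigO.of_bound (Real.log 4 + 4) (Eventually.of_forall fun n ↦ ?_)
    have := psi_le_const_mul_self n.cast_nonneg
    rw [psi, Nat.floor_natCast] at this
    rw [rpow_one, _root_.norm_natCast,
      norm_of_nonneg (Finset.sum_nonneg fun i _ ↦ vonMangoldt_nonneg)]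
    exact this

/-- The prime number theorem, for Chebyshev's function `ψ`. -/
theorem tendsto_psi_div_self : Tendsto (fun x ↦ psi x / x) atTop (nhds 1) := by
  set f : ℝ → ℝ := fun t ↦ psi (rexp t) * rexp (-t) with hf
  set B : ℝ := Real.log 4 + 4 with hB
  have hfm : Measurable f := (psi_mono.measurable.comp measurable_exp).mul (by fun_prop)
  have hf0 (t : ℝ) : 0 ≤ f t := mul_nonneg (psi_nonneg _) (exp_pos _).le
  have hfB (t : ℝ) : f t ≤ B := by
    have := psi_le_const_mul_self (exp_pos t).le
    rw [hf]
    simp only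
    rw [exp_neg, mul_inv_le_iff₀ (exp_pos t)]
    exact this
  have hmono : Monotone fun t ↦ rexp t * f t := by
    have : (fun t ↦ rexp t * f t) = fun t ↦ psi (rexp t) := by
      ext t
      rw [hf]
      simp only
      rw [mul_left_comm, ← exp_add, add_neg_cancel, exp_zero, mul_one]
    rw [this]
    exact psi_mono.comp exp_monotone
  let H := vonMangoldt.LFunctionResidueClassAux (q := 1) 1
  have hH {s : ℂ} (hs : 0 < s.re) : H (s + 1) = LSeries (fun n ↦ (Λ n : ℂ)) (s + 1) - 1 / s := by
    simp only [H]
    rw [vonMangoldt.eqOn_LFunctionResidueClassAux isUnit_one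
      (by simpa using hs : s + 1 ∈ {s : ℂ | 1 < s.re})]
    have h1 (n : ℕ) : vonMangoldt.residueClass (q := 1) 1 n = Λ n := by
      simp [vonMangoldt.residueClass, Subsingleton.elim (n : ZMod 1) 1]
    simp [h1]
  have hexp {s : ℂ} (hs : 0 < s.re) :
      IntegrableOn (fun t : ℝ ↦ Complex.exp (-s * t)) (Ioi 0) :=
    integrableOn_exp_mul_complex_Ioi (by simpa using hs) 0
  have hlap (s : ℂ) (hs : 0 < s.re) : (H (s + 1) - 1) / (s + 1) =
      ∫ t in Ioi (0 : ℝ), ((f t - 1 : ℝ) : ℂ) * Complex.exp (-s * t) := by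
    have hs0 : s ≠ 0 := fun h ↦ by simp [h] at hs
    have hs1 : s + 1 ≠ 0 := fun h ↦ by
      have := congrArg Complex.re h
      simp at this
      linarith
    have h1 : IntegrableOn (fun t : ℝ ↦ (f t : ℂ) * Complex.exp (-s * t)) (Ioi 0) := by
      refine (hexp hs).bdd_mul (c := B) (by fun_prop) (ae_of_all _ fun t ↦ ?_)
      rw [Complex.norm_real, norm_of_nonneg (hf0 t)]
      exact hfB t
    simp only [Complex.ofReal_sub, Complex.ofReal_one, sub_mul, one_mul]
    rw [integral_sub h1 (hexp hs), integral_exp_mul_complex_Ioi (by simpa using hs), hH hs,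
      LSeries_vonMangoldt_eq_mul_integral_psi hs]
    simp only [Complex.ofReal_zero, mul_zero, Complex.exp_zero]
    field_simp
    ring
  have hcont : ContinuousOn (fun s ↦ (H (s + 1) - 1) / (s + 1)) {s | 0 ≤ s.re} := by
    refine ContinuousOn.div (ContinuousOn.sub ?_ continuousOn_const) (by fun_prop) fun s hs h ↦ ?_
    · exact (vonMangoldt.continuousOn_LFunctionResidueClassAux 1).comp (by fun_prop)
        fun s hs ↦ by simpa using hs
    · have := congrArg Complex.re h
      simp only [mem_ofPred_eq] at hs
      simp at this
      linarith
  have hlim := tendsto_one_of_tendsto_integral_fejerKernel hfm (fun t _ ↦ hf0 t) (fun t _ ↦ hfB t)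
    (hmono.monotoneOn _) fun l hl ↦ tendsto_integral_mul_fejerKernel (B := B + 1)
      (hfm.sub_const 1) (fun t _ ↦ abs_le.2 ⟨?_, ?_⟩) hlap hcont hl
  · refine (hlim.comp tendsto_log_atTop).congr' ?_
    filter_upwards [eventually_gt_atTop 0] with x hx
    simp [hf, exp_neg, exp_log hx, div_eq_mul_inv]
  · have h4 : 0 ≤ Real.log 4 := log_nonneg (by norm_num)
    linarith [hf0 t]
  · linarith [hfB t]

/-- The prime number theorem. -/
theorem tendsto_primeCounting_mul_log_div :
    Tendsto (fun x : ℝ ↦ (⌊x⌋₊.primeCounting : ℝ) * Real.log x / x) atTop (nhds 1) := by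
  have hx0 : ∀ᶠ x : ℝ in atTop, x ≠ 0 := eventually_ne_atTop 0
  have h1 : Tendsto (fun x ↦ theta x / x) atTop (nhds 1) := by
    have h : (psi - theta) =o[atTop] (fun x : ℝ ↦ x) := by
      refine isBigO_psi_sub_theta_sqrt.trans_isLittleO ?_
      rw [Asymptotics.isLittleO_iff_tendsto fun x hx ↦ by simp [hx]]
      simpa [sqrt_div_self, Function.comp_def] using tendsto_inv_atTop_zero.comp tendsto_sqrt_atTop
    have := tendsto_psi_div_self.sub h.tendsto_div_nhds_zero
    simp only [sub_zero] at this
    refine this.congr fun x ↦ ?_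
    simp only [Pi.sub_apply]
    ring
  have h2 : Tendsto (fun x : ℝ ↦ (⌊x⌋₊.primeCounting - theta x / Real.log x) * Real.log x / x) atTop
      (nhds 0) := by
    have h : (fun x : ℝ ↦ x / Real.log x ^ 2) =o[atTop] (fun x : ℝ ↦ x / Real.log x) := by
      rw [Asymptotics.isLittleO_iff_tendsto']
      · refine (tendsto_inv_atTop_zero.comp tendsto_log_atTop).congr' ?_
        filter_upwards [eventually_gt_atTop 1] with x hx
        have := log_pos hx
        simp only [Function.comp_apply]
        field_simp
      · filter_upwards [eventually_gt_atTop 1] with x hx h0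
        have := log_pos hx
        have : x / Real.log x > 0 := by positivity
        linarith
    refine (primeCounting_sub_theta_div_log_isBigO.trans_isLittleO h).tendsto_div_nhds_zero.congr
      fun x ↦ ?_
    rw [div_div_eq_mul_div]
  have := h1.add h2
  simp only [add_zero] at this
  refine this.congr' ?_
  filter_upwards [eventually_gt_atTop 1] with x hx
  have := log_pos hx
  field_simp
  ring

end PrimeNumberTheorem

section Mertens

open MeasureTheory Set

lemma tendsto_log_log_atTop : Tendsto (fun x ↦ log (log x)) atTop atTop :=
  tendsto_log_atTop.comp tendsto_log_atTop

lemma continuousOn_inv_mul_log {a b : ℝ} (ha : 1 < a) :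
    ContinuousOn (fun t ↦ (t * log t)⁻¹) (Icc a b) := fun t ht ↦ by
  have ht1 : 1 < t := ha.trans_le ht.1
  have h1 : t ≠ 0 := by linarith
  have h2 : t * log t ≠ 0 := mul_ne_zero h1 (log_pos ht1).ne'
  exact ContinuousAt.continuousWithinAt (by fun_prop (disch := assumption))

lemma integral_inv_mul_log {a b : ℝ} (ha : 1 < a) (hab : a ≤ b) :
    ∫ t in a..b, (t * log t)⁻¹ = log (log b) - log (log a) := by
  refine intervalIntegral.integral_eq_sub_of_hasDerivAt (f := fun t ↦ log (log t))
    (fun t ht ↦ ?_) ?_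
  · rw [uIcc_of_le hab] at ht
    have ht1 : 1 < t := ha.trans_le ht.1
    refine ((hasDerivAt_log (by linarith : t ≠ 0)).log (log_pos ht1).ne').congr_deriv ?_
    rw [mul_inv, div_eq_mul_inv]
  · refine ContinuousOn.intervalIntegrable ?_
    rw [uIcc_of_le hab]
    exact continuousOn_inv_mul_log ha

lemma tendsto_integral_div_log_log {φ : ℝ → ℝ} {a : ℝ} (ha : 1 < a)
    (hφ : ∀ b ≥ a, IntervalIntegrable φ volume a b)
    (hlim : Tendsto (fun t ↦ φ t * (t * log t)) atTop (nhds 1)) :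
    Tendsto (fun x ↦ (∫ t in a..x, φ t) / log (log x)) atTop (nhds 1) := by
  have hinv {c d : ℝ} (hc : 1 < c) (hcd : c ≤ d) :
      IntervalIntegrable (fun t ↦ (t * log t)⁻¹) volume c d := by
    refine ContinuousOn.intervalIntegrable ?_
    rw [uIcc_of_le hcd]
    exact continuousOn_inv_mul_log hc
  rw [tendsto_iff_norm_sub_tendsto_zero]
  refine tendsto_order.2 ⟨fun c hc ↦ Eventually.of_forall fun x ↦ hc.trans_le (norm_nonneg _),
    fun ε hε ↦ ?_⟩
  have h1 : ∀ᶠ t in atTop, |φ t - (t * log t)⁻¹| ≤ ε / 2 * (t * log t)⁻¹ := by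
    have := (tendsto_iff_norm_sub_tendsto_zero.1 hlim).eventually_le_const (half_pos hε)
    filter_upwards [this, eventually_gt_atTop 1] with t ht ht1
    have h2 : 0 < t * log t := mul_pos (by linarith) (log_pos ht1)
    rw [norm_eq_abs] at ht
    rw [← div_eq_mul_inv, le_div_iff₀ h2, ← abs_of_pos h2, ← abs_mul, abs_of_pos h2, sub_mul,
      inv_mul_cancel₀ h2.ne']
    exact ht
  obtain ⟨T, hT⟩ := eventually_atTop.1 (h1.and (eventually_ge_atTop a))
  have hTa : a ≤ T := (hT T le_rfl).2
  have hT1 : 1 < T := ha.trans_le hTa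
  set K := |(∫ t in a..T, φ t) - log (log T)| + ε / 2 * |log (log T)| with hKdef
  have hK : Tendsto (fun x ↦ K / log (log x)) atTop (nhds 0) :=
    tendsto_const_nhds.div_atTop tendsto_log_log_atTop
  filter_upwards [hK.eventually_lt_const (half_pos hε), eventually_ge_atTop T,
    tendsto_log_log_atTop.eventually_gt_atTop 0] with x hx hxT hx0
  have hφT : IntervalIntegrable φ volume T x := (hφ T hTa).symm.trans (hφ x (hTa.trans hxT))
  have h3 : |(∫ t in T..x, φ t) - (log (log x) - log (log T))| ≤
      ε / 2 * (log (log x) - log (log T)) := by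
    rw [← integral_inv_mul_log hT1 hxT, ← intervalIntegral.integral_sub hφT (hinv hT1 hxT),
      ← intervalIntegral.integral_const_mul]
    refine (intervalIntegral.abs_integral_le_integral_abs hxT).trans ?_
    exact intervalIntegral.integral_mono_on hxT (hφT.sub (hinv hT1 hxT)).abs
      ((hinv hT1 hxT).const_mul _) fun t ht ↦ (hT t ht.1).1
  have h4 := intervalIntegral.integral_add_adjacent_intervals (hφ T hTa) hφT
  rw [norm_eq_abs, div_sub_one hx0.ne', abs_div, abs_of_pos hx0, div_lt_iff₀ hx0, ← h4]
  rw [div_lt_iff₀ hx0, hKdef] at hx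
  have h5 := abs_add_le ((∫ t in a..T, φ t) - log (log T))
    ((∫ t in T..x, φ t) - (log (log x) - log (log T)))
  have h6 : -(ε / 2 * log (log T)) ≤ ε / 2 * |log (log T)| := by
    have := mul_le_mul_of_nonneg_left (neg_abs_le (log (log T))) (half_pos hε).le
    linarith
  rw [show (∫ t in a..T, φ t) + (∫ t in T..x, φ t) - log (log x) =
    (∫ t in a..T, φ t) - log (log T) + ((∫ t in T..x, φ t) - (log (log x) - log (log T))) by ring]
  linarith

lemma sum_inv_primesLE_eq {x : ℝ} (hx : 2 ≤ x) :
    ∑ p ∈ Nat.primesLE ⌊x⌋₊, (p : ℝ)⁻¹ =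
      ⌊x⌋₊.primeCounting / x + ∫ t in (2 : ℝ)..x, ⌊t⌋₊.primeCounting / t ^ 2 := by
  let c : ℕ → ℝ := fun n ↦ if n.Prime then 1 else 0
  have hc (n : ℕ) : ∑ k ∈ Finset.Icc 0 n, c k = n.primeCounting := by
    rw [← Nat.primesLE_card_eq_primeCounting, Nat.primesLE_eq_filter_range,
      Nat.range_succ_eq_Icc_zero, Finset.card_filter]
    push_cast
    rfl
  have h := sum_mul_eq_sub_integral_mul₁ c (f := fun t ↦ t⁻¹) (by simp [c, Nat.not_prime_zero])
    (by simp [c, Nat.not_prime_one]) x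
    (fun t ht ↦ differentiableAt_inv (by linarith [ht.1] : t ≠ 0)) ?_
  · simp only [hc, deriv_inv'] at h
    rw [intervalIntegral.integral_of_le hx, div_eq_inv_mul, Nat.primesLE_eq_filter_range,
      Nat.range_succ_eq_Icc_zero, Finset.sum_filter]
    simp only [c, mul_ite, mul_one, mul_zero] at h
    rw [h, sub_eq_add_neg, ← integral_neg]
    congr 2 with t
    field_simp
  · simp only [deriv_inv']
    refine ContinuousOn.integrableOn_Icc fun t ht ↦ ?_
    have : t ^ 2 ≠ 0 := pow_ne_zero 2 (by linarith [ht.1])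
    exact ContinuousAt.continuousWithinAt (by fun_prop (disch := assumption))

/-- A weak form of Mertens' second theorem. -/
lemma tendsto_sum_inv_primesLE_div_log_log :
    Tendsto (fun x : ℝ ↦ (∑ p ∈ Nat.primesLE ⌊x⌋₊, (p : ℝ)⁻¹) / log (log x)) atTop (nhds 1) := by
  have h1 : Tendsto (fun x : ℝ ↦ (⌊x⌋₊.primeCounting : ℝ) / x) atTop (nhds 0) := by
    have := tendsto_primeCounting_mul_log_div.div_atTop tendsto_log_atTop
    refine this.congr' ?_
    filter_upwards [eventually_gt_atTop 1] with x hx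
    have := log_pos hx
    field_simp
  have h2 := tendsto_integral_div_log_log one_lt_two
    (φ := fun t ↦ (⌊t⌋₊.primeCounting : ℝ) / t ^ 2) ?_ ?_
  · have := (h1.div_atTop tendsto_log_log_atTop).add h2
    rw [zero_add] at this
    refine this.congr' ?_
    filter_upwards [eventually_ge_atTop 2] with x hx
    rw [sum_inv_primesLE_eq hx, add_div]
  · intro b hb
    have hmono : Monotone fun t : ℝ ↦ (⌊t⌋₊.primeCounting : ℝ) := fun s t hst ↦ by
      simp only [Nat.cast_le]
      exact Nat.monotone_primeCounting (Nat.floor_mono hst)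
    simp only [div_eq_mul_inv]
    refine hmono.intervalIntegrable.mul_continuousOn ?_
    rw [uIcc_of_le hb]
    intro t ht
    have : t ^ 2 ≠ 0 := pow_ne_zero 2 (by linarith [ht.1])
    exact ContinuousAt.continuousWithinAt (by fun_prop (disch := assumption))
  · refine tendsto_primeCounting_mul_log_div.congr' ?_
    filter_upwards [eventually_gt_atTop 1] with x hx
    have : x ≠ 0 := by linarith
    field_simp

lemma tendsto_sum_inv_primesLE_rpow_div_log_log {c : ℝ} (hc : 0 < c) :
    Tendsto (fun x : ℝ ↦ (∑ p ∈ Nat.primesLE ⌊x ^ c⌋₊, (p : ℝ)⁻¹) / log (log x))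
      atTop (nhds 1) := by
  have h1 : Tendsto (fun x ↦ log (log (x ^ c)) / log (log x)) atTop (nhds 1) := by
    have : Tendsto (fun x ↦ log c / log (log x) + 1) atTop (nhds (0 + 1)) :=
      (tendsto_const_nhds.div_atTop tendsto_log_log_atTop).add_const 1
    rw [zero_add] at this
    refine this.congr' ?_
    filter_upwards [eventually_gt_atTop 1, tendsto_log_log_atTop.eventually_gt_atTop 0]
      with x hx hx0
    rw [log_rpow (by linarith), log_mul hc.ne' (log_pos hx).ne', add_div, div_self hx0.ne']
  have h2 := (tendsto_sum_inv_primesLE_div_log_log.comp (tendsto_rpow_atTop hc)).mul h1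
  rw [one_mul] at h2
  refine h2.congr' ?_
  filter_upwards [(tendsto_log_log_atTop.comp (tendsto_rpow_atTop hc)).eventually_gt_atTop 0]
    with x hx
  simp only [Function.comp_apply] at hx ⊢
  field_simp

end Mertens

section Semiprime

lemma length_primeFactorsList_mul {p q : ℕ} (hp : p.Prime) (hq : q.Prime) :
    (p * q).primeFactorsList.length = 2 := by
  rw [← ArithmeticFunction.cardFactors_apply,
    ArithmeticFunction.cardFactors_mul hp.ne_zero hq.ne_zero,
    ArithmeticFunction.cardFactors_apply_prime hp, ArithmeticFunction.cardFactors_apply_prime hq]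

lemma exists_prime_le_prime_of_length_eq_two {m : ℕ} (hm : m.primeFactorsList.length = 2) :
    ∃ p q : ℕ, p.Prime ∧ q.Prime ∧ p ≤ q ∧ p * q = m := by
  obtain ⟨a, b, hab⟩ := List.length_eq_two.1 hm
  have ha : a.Prime := Nat.prime_of_mem_primeFactorsList (n := m) (by simp [hab])
  have hb : b.Prime := Nat.prime_of_mem_primeFactorsList (n := m) (by simp [hab])
  have hm0 : m ≠ 0 := by
    rintro rfl
    simp at hm
  have h := Nat.prod_primeFactorsList hm0
  simp only [hab, List.prod_cons, List.prod_nil, mul_one] at h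
  rcases le_total a b with hle | hle
  · exact ⟨a, b, ha, hb, hle, h⟩
  · exact ⟨b, a, hb, ha, hle, by rw [mul_comm, h]⟩

lemma semiprimeCount_le (x : ℝ) :
    semiprimeCount x ≤ ∑ p ∈ Nat.primesLE ⌊√x⌋₊, ⌊x / p⌋₊.primeCounting := by
  let T := (Nat.primesLE ⌊√x⌋₊).sigma fun p ↦ Nat.primesLE ⌊x / p⌋₊
  have hsub : {m : ℕ | 0 < m ∧ m.primeFactorsList.length = 2 ∧ (m : ℝ) ≤ x} ⊆
      (T.image fun z ↦ z.1 * z.2 : Finset ℕ) := by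
    rintro m ⟨-, hm, hmx⟩
    obtain ⟨p, q, hp, hq, hpq, rfl⟩ := exists_prime_le_prime_of_length_eq_two hm
    push_cast at hmx
    have hp0 : (0 : ℝ) < p := by exact_mod_cast hp.pos
    have hpq' : (p : ℝ) ≤ q := by exact_mod_cast hpq
    simp only [Finset.coe_image, Set.mem_image, Finset.mem_coe, T, Finset.mem_sigma,
      Nat.mem_primesLE]
    refine ⟨⟨p, q⟩, ⟨⟨?_, hp⟩, ?_, hq⟩, rfl⟩
    · exact Nat.le_floor (le_sqrt_of_sq_le (by nlinarith))
    · exact Nat.le_floor ((le_div_iff₀ hp0).2 (by linarith))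
  calc semiprimeCount x ≤ (T.image fun z ↦ z.1 * z.2).card := by
        rw [semiprimeCount, ← Set.ncard_coe_finset]
        exact Set.ncard_le_ncard hsub (Finset.finite_toSet _)
    _ ≤ T.card := Finset.card_image_le
    _ = _ := by simp [T, Nat.primesLE_card_eq_primeCounting]

lemma sum_primeCounting_le {x : ℝ} (hx : 0 ≤ x) :
    ∑ p ∈ Nat.primesLE ⌊√x⌋₊, ⌊x / p⌋₊.primeCounting ≤
      semiprimeCount x + ⌊√x⌋₊.primeCounting ^ 2 := by
  set s := ⌊√x⌋₊
  let T := (Nat.primesLE s).sigma fun p ↦ Nat.primesLE ⌊x / p⌋₊ \ Nat.primesLE s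
  have hT : T.card ≤ semiprimeCount x := by
    have hinj : Set.InjOn (fun z : (_ : ℕ) × ℕ ↦ z.1 * z.2) (T : Set ((_ : ℕ) × ℕ)) := by
      rintro ⟨p, q⟩ hz ⟨p', q'⟩ hz' h
      simp only [Finset.mem_coe, T, Finset.mem_sigma, Finset.mem_sdiff,
        Nat.mem_primesLE] at hz hz' h
      obtain ⟨⟨hps, hp⟩, ⟨-, hq⟩, hqs⟩ := hz
      obtain ⟨⟨hps', hp'⟩, ⟨-, hq'⟩, hqs'⟩ := hz'
      have hpp : p = p' := by
        rcases (Nat.Prime.dvd_mul hp).1 (h ▸ Dvd.intro q rfl : p ∣ p' * q') with h1 | h1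
        · exact (Nat.prime_dvd_prime_iff_eq hp hp').1 h1
        · rw [(Nat.prime_dvd_prime_iff_eq hp hq').1 h1] at hps
          exact absurd ⟨hps, hq'⟩ hqs'
      subst hpp
      rw [Nat.eq_of_mul_eq_mul_left hp.pos h]
    rw [← Finset.card_image_of_injOn hinj, semiprimeCount, ← Set.ncard_coe_finset]
    refine Set.ncard_le_ncard ?_ ?_
    · intro m hm
      simp only [Finset.coe_image, Set.mem_image, Finset.mem_coe, T, Finset.mem_sigma,
        Finset.mem_sdiff, Nat.mem_primesLE] at hm
      obtain ⟨⟨p, q⟩, ⟨⟨-, hp⟩, ⟨hqx, hq⟩, -⟩, rfl⟩ := hm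
      refine ⟨mul_pos hp.pos hq.pos, length_primeFactorsList_mul hp hq, ?_⟩
      have hp0 : (0 : ℝ) < p := by exact_mod_cast hp.pos
      have := (le_div_iff₀ hp0).1 ((Nat.le_floor_iff (by positivity)).1 hqx)
      push_cast
      linarith
    · exact (Set.finite_Iic ⌊x⌋₊).subset fun m hm ↦ Nat.le_floor hm.2.2
  calc ∑ p ∈ Nat.primesLE s, ⌊x / p⌋₊.primeCounting
      ≤ ∑ p ∈ Nat.primesLE s, ((Nat.primesLE ⌊x / p⌋₊ \ Nat.primesLE s).card +
          s.primeCounting) := by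
        refine Finset.sum_le_sum fun p _ ↦ ?_
        rw [← Nat.primesLE_card_eq_primeCounting, ← Nat.primesLE_card_eq_primeCounting]
        exact Finset.card_le_card_sdiff_add_card
    _ = T.card + s.primeCounting ^ 2 := by
        rw [Finset.sum_add_distrib, Finset.sum_const, Nat.primesLE_card_eq_primeCounting,
          Finset.card_sigma, smul_eq_mul, sq]
    _ ≤ _ := by gcongr

lemma eventually_le_primeCounting {ε : ℝ} (hε : 0 < ε) :
    ∀ᶠ y : ℝ in atTop, (1 - ε) * (y / log y) ≤ ⌊y⌋₊.primeCounting := by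
  filter_upwards [tendsto_primeCounting_mul_log_div.eventually_const_le (sub_lt_self 1 hε),
    eventually_gt_atTop 1] with y hy hy1
  have := log_pos hy1
  rw [← mul_div_assoc, div_le_iff₀ this]
  rwa [le_div_iff₀ (by linarith)] at hy

lemma eventually_primeCounting_le {ε : ℝ} (hε : 0 < ε) :
    ∀ᶠ y : ℝ in atTop, ⌊y⌋₊.primeCounting ≤ (1 + ε) * (y / log y) := by
  filter_upwards [tendsto_primeCounting_mul_log_div.eventually_le_const (lt_add_of_pos_right 1 hε),
    eventually_gt_atTop 1] with y hy hy1
  have := log_pos hy1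
  rw [← mul_div_assoc, le_div_iff₀ this]
  rwa [div_le_iff₀ (by linarith)] at hy

lemma sqrt_le_div_of_mem_primesLE {x : ℝ} {p : ℕ} (hp : p ∈ Nat.primesLE ⌊√x⌋₊) :
    √x ≤ x / p := by
  obtain ⟨h1, h2⟩ := Nat.mem_primesLE.1 hp
  have hp0 : (0 : ℝ) < p := by exact_mod_cast h2.pos
  have h3 : (p : ℝ) ≤ √x := (Nat.le_floor_iff (sqrt_nonneg x)).1 h1
  have hx : 0 ≤ x := (sqrt_pos.1 (hp0.trans_le h3)).le
  rw [le_div_iff₀ hp0]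
  nlinarith [sq_sqrt hx, sqrt_nonneg x]

lemma eventually_le_sum_primeCounting {ε : ℝ} (hε : 0 < ε) (hε1 : ε < 1) :
    ∀ᶠ x : ℝ in atTop, (1 - ε) * (x / log x) * ∑ p ∈ Nat.primesLE ⌊√x⌋₊, (p : ℝ)⁻¹ ≤
      ∑ p ∈ Nat.primesLE ⌊√x⌋₊, (⌊x / p⌋₊.primeCounting : ℝ) := by
  obtain ⟨T, hT⟩ := eventually_atTop.1 (eventually_le_primeCounting hε)
  filter_upwards [tendsto_sqrt_atTop.eventually_ge_atTop T, eventually_gt_atTop 1] with x hx hx1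
  rw [Finset.mul_sum]
  refine Finset.sum_le_sum fun p hp ↦ ?_
  have h1 := sqrt_le_div_of_mem_primesLE hp
  have hp1 : (1 : ℝ) ≤ p := by exact_mod_cast (Nat.prime_of_mem_primesLE hp).one_le
  have h2 : 1 < x / p := ((lt_sqrt zero_le_one).2 (by simpa using hx1)).trans_le h1
  have h3 := log_pos h2
  refine le_trans ?_ (hT _ (hx.trans h1))
  rw [mul_assoc]
  refine mul_le_mul_of_nonneg_left ?_ (by linarith)
  rw [div_mul_eq_mul_div, ← div_eq_mul_inv]
  gcongr
  exact div_le_self (by linarith) hp1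

lemma eventually_sum_primeCounting_le {ε : ℝ} (hε : 0 < ε) (hε1 : ε < 1 / 2) :
    ∀ᶠ x : ℝ in atTop, ∑ p ∈ Nat.primesLE ⌊√x⌋₊, (⌊x / p⌋₊.primeCounting : ℝ) ≤
      (1 + ε) * (x / log x) * ((1 - ε)⁻¹ * ∑ p ∈ Nat.primesLE ⌊√x⌋₊, (p : ℝ)⁻¹ +
        2 * (∑ p ∈ Nat.primesLE ⌊√x⌋₊, (p : ℝ)⁻¹ - ∑ p ∈ Nat.primesLE ⌊x ^ ε⌋₊, (p : ℝ)⁻¹)) := by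
  obtain ⟨T, hT⟩ := eventually_atTop.1 (eventually_primeCounting_le hε)
  filter_upwards [tendsto_sqrt_atTop.eventually_ge_atTop T, eventually_gt_atTop 1] with x hx hx1
  have hx0 : 0 < x := by linarith
  have hlog := log_pos hx1
  have hsub : Nat.primesLE ⌊x ^ ε⌋₊ ⊆ Nat.primesLE ⌊√x⌋₊ := by
    refine Nat.primesLE_mono (Nat.floor_mono ?_)
    rw [sqrt_eq_rpow]
    exact rpow_le_rpow_of_exponent_le hx1.le hε1.le
  have hle : ∑ p ∈ Nat.primesLE ⌊√x⌋₊, (⌊x / p⌋₊.primeCounting : ℝ) ≤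
      ∑ p ∈ Nat.primesLE ⌊√x⌋₊, (1 + ε) * (x / log x) * ((1 - ε)⁻¹ * (p : ℝ)⁻¹ +
        2 * if p ∈ Nat.primesLE ⌊x ^ ε⌋₊ then 0 else (p : ℝ)⁻¹) := by
    refine Finset.sum_le_sum fun p hp ↦ ?_
    have hp0 : (0 : ℝ) < p := by exact_mod_cast (Nat.prime_of_mem_primesLE hp).pos
    have h1 := sqrt_le_div_of_mem_primesLE hp
    refine (hT _ (hx.trans h1)).trans ?_
    rw [mul_assoc]
    refine mul_le_mul_of_nonneg_left ?_ (by linarith)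
    have hε2 : 0 < 1 - ε := by linarith
    split_ifs with h
    · have h2 : (1 - ε) * log x ≤ log (x / p) := by
        have h3 : (p : ℝ) ≤ x ^ ε :=
          (Nat.le_floor_iff (by positivity)).1 (Nat.le_of_mem_primesLE h)
        have h4 := log_le_log hp0 h3
        rw [log_rpow hx0] at h4
        rw [log_div hx0.ne' hp0.ne']
        linarith
      calc x / p / log (x / p) ≤ x / p / ((1 - ε) * log x) := by gcongr
        _ = _ := by field_simp; ring
    · have h2 : log x / 2 ≤ log (x / p) := by
        rw [← log_sqrt hx0.le]
        exact log_le_log (sqrt_pos.2 hx0) h1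
      calc x / p / log (x / p) ≤ x / p / (log x / 2) := by gcongr
        _ = x / log x * (2 * (p : ℝ)⁻¹) := by field_simp
        _ ≤ _ := by
          gcongr
          exact le_add_of_nonneg_left (by positivity)
  have hsdiff : ∑ p ∈ Nat.primesLE ⌊√x⌋₊, (if p ∈ Nat.primesLE ⌊x ^ ε⌋₊ then 0 else (p : ℝ)⁻¹) =
      ∑ p ∈ Nat.primesLE ⌊√x⌋₊, (p : ℝ)⁻¹ - ∑ p ∈ Nat.primesLE ⌊x ^ ε⌋₊, (p : ℝ)⁻¹ := by
    rw [← Finset.sum_sdiff_eq_sub hsub, ← Finset.sum_sdiff hsub,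
      Finset.sum_eq_zero (s := Nat.primesLE ⌊x ^ ε⌋₊) (fun p hp ↦ by rw [if_pos hp]), add_zero]
    exact Finset.sum_congr rfl fun p hp ↦ by rw [if_neg (Finset.mem_sdiff.1 hp).2]
  refine hle.trans_eq ?_
  rw [← Finset.mul_sum, Finset.sum_add_distrib, ← Finset.mul_sum, ← Finset.mul_sum, hsdiff]

lemma tendsto_primeCounting_sqrt_sq :
    Tendsto (fun x : ℝ ↦ (⌊√x⌋₊.primeCounting : ℝ) ^ 2 * log x / (x * log (log x)))
      atTop (nhds 0) := by
  have h1 := ((tendsto_primeCounting_mul_log_div.comp tendsto_sqrt_atTop).pow 2).const_mul 4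
  have h2 := (h1.div_atTop tendsto_log_atTop).div_atTop tendsto_log_log_atTop
  refine h2.congr' ?_
  filter_upwards [eventually_gt_atTop 1] with x hx
  have hlog := log_pos hx
  have hx0 : 0 < x := by linarith
  simp only [Function.comp_apply]
  rw [log_sqrt hx0.le, div_pow, sq_sqrt hx0.le]
  field_simp
  ring

end Semiprime

/-- (Landau) π₂(x) ∼ (x / log x) · log log x as x → ∞. -/
theorem landau_semiprime_asymptotic :
    Tendsto (fun x : ℝ =>
        (semiprimeCount x : ℝ) * Real.log x / (x * Real.log (Real.log x)))
      atTop (nhds 1) := by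
  have hS : Tendsto (fun x : ℝ ↦ (∑ p ∈ Nat.primesLE ⌊√x⌋₊, (p : ℝ)⁻¹) / log (log x))
      atTop (nhds 1) := by
    simp only [sqrt_eq_rpow]
    exact tendsto_sum_inv_primesLE_rpow_div_log_log one_half_pos
  refine tendsto_order.2 ⟨fun a ha ↦ ?_, fun a ha ↦ ?_⟩
  · have hlim : Tendsto (fun ε : ℝ ↦ 1 - ε) (nhdsWithin 0 (Set.Ioi 0)) (nhds 1) := by
      have : Tendsto (fun ε : ℝ ↦ 1 - ε) (nhds 0) (nhds (1 - 0)) :=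
        Continuous.tendsto (by fun_prop) 0
      rw [sub_zero] at this
      exact this.mono_left nhdsWithin_le_nhds
    obtain ⟨ε, hεa, hε0, hε1⟩ := ((hlim.eventually_const_lt ha).and
      (Ioo_mem_nhdsGT (zero_lt_one' ℝ))).exists
    have h1 := (hS.const_mul (1 - ε)).sub tendsto_primeCounting_sqrt_sq
    rw [mul_one, sub_zero] at h1
    filter_upwards [h1.eventually_const_lt hεa, eventually_le_sum_primeCounting hε0 hε1,
      eventually_gt_atTop 1, tendsto_log_log_atTop.eventually_gt_atTop 0] with x hx h2 hx1 hll
    refine hx.trans_le ?_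
    have hlog := log_pos hx1
    have hx0 : 0 < x := by linarith
    have h3 : (∑ p ∈ Nat.primesLE ⌊√x⌋₊, (⌊x / p⌋₊.primeCounting : ℝ)) ≤
        semiprimeCount x + (⌊√x⌋₊.primeCounting : ℝ) ^ 2 := by
      exact_mod_cast sum_primeCounting_le hx0.le
    rw [sub_le_iff_le_add, ← add_div, ← add_mul]
    refine le_trans (le_of_eq ?_) (div_le_div_of_nonneg_right
      (mul_le_mul_of_nonneg_right (h2.trans h3) hlog.le) (by positivity))
    field_simp
  · have hlim : Tendsto (fun ε : ℝ ↦ (1 + ε) * (1 - ε)⁻¹) (nhdsWithin 0 (Set.Ioi 0)) (nhds 1) := by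
      have : ContinuousAt (fun ε : ℝ ↦ (1 + ε) * (1 - ε)⁻¹) 0 :=
        ContinuousAt.mul (by fun_prop) (ContinuousAt.inv₀ (by fun_prop) (by simp))
      simpa using this.tendsto.mono_left (nhdsWithin_le_nhds (s := Set.Ioi 0))
    obtain ⟨ε, hεa, hε0, hε1⟩ := ((hlim.eventually_lt_const ha).and
      (Ioo_mem_nhdsGT (one_half_pos (α := ℝ)))).exists
    have h1 := ((hS.const_mul (1 - ε)⁻¹).add ((hS.sub
      (tendsto_sum_inv_primesLE_rpow_div_log_log hε0)).const_mul 2)).const_mul (1 + ε)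
    rw [mul_one, sub_self, mul_zero, add_zero] at h1
    filter_upwards [h1.eventually_lt_const hεa, eventually_sum_primeCounting_le hε0 hε1,
      eventually_gt_atTop 1, tendsto_log_log_atTop.eventually_gt_atTop 0] with x hx h2 hx1 hll
    refine lt_of_le_of_lt ?_ hx
    have hlog := log_pos hx1
    have hx0 : 0 < x := by linarith
    have h3 : (semiprimeCount x : ℝ) ≤
        ∑ p ∈ Nat.primesLE ⌊√x⌋₊, (⌊x / p⌋₊.primeCounting : ℝ) := by
      exact_mod_cast semiprimeCount_le x
    refine (div_le_div_of_nonneg_right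
      (mul_le_mul_of_nonneg_right (h3.trans h2) hlog.le) (by positivity)).trans_eq ?_
    field_simp
end
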